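/- Every circulant Hadamard matrix of order n ≥ 4 satisfies n = 4h² for some positive odd integer h, and its row sums are all equal to either 2h or −2h. -/

import Mathlib

open Matrix BigOperators

theorem exists_sub_one_pow_two_pow {A : Type*} [CommRing A] (x : A) (k : ℕ) :
    ∃ s, (x - 1) ^ 2 ^ k = x ^ 2 ^ k - 1 + 2 * (x - 1) * s := by
  induction k with
  | zero => exact ⟨0, by simp⟩
  | succ k ih =>
    obtain ⟨s, hs⟩ := ih
    obtain ⟨q, hq⟩ := sub_one_dvd_pow_sub_one x (2 ^ k)
    refine ⟨2 * (x ^ 2 ^ k - 1) * s + 2 * (x - 1) * s ^ 2 - q, ?_⟩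
    rw [pow_succ, pow_mul, hs, pow_mul]
    linear_combination (-2) * hq

theorem sub_one_pow_dvd_two {A : Type*} [CommRing A] {x : A} {k : ℕ} (hx : x ^ 2 ^ k = -1) :
    (x - 1) ^ 2 ^ k ∣ 2 := by
  obtain ⟨s, hs⟩ := exists_sub_one_pow_two_pow x k
  rw [hx] at hs
  have key : ∀ j : ℕ, (x - 1) ^ 2 ^ k ∣ 2 - 2 * ((x - 1) * s) ^ j := by
    intro j
    induction j with
    | zero => simp
    | succ j ih =>
      have h : 2 - 2 * ((x - 1) * s) ^ (j + 1) =
          (x - 1) * s * (2 - 2 * ((x - 1) * s) ^ j) - (x - 1) ^ 2 ^ k := by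
        rw [hs]; ring
      rw [h]
      exact dvd_sub (ih.mul_left _) dvd_rfl
  have h := dvd_add (key (2 ^ k)) (Dvd.intro (2 * s ^ 2 ^ k) (by rw [mul_pow]; ring) :
    (x - 1) ^ 2 ^ k ∣ 2 * ((x - 1) * s) ^ 2 ^ k)
  simpa using h

theorem two_dvd_sub_one_pow {A : Type*} [CommRing A] {x : A} {k : ℕ} (hx : x ^ 2 ^ k = -1) :
    2 ∣ (x - 1) ^ 2 ^ k := by
  obtain ⟨s, hs⟩ := exists_sub_one_pow_two_pow x k
  exact ⟨(x - 1) * s - 1, by rw [hs, hx]; ring⟩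

/-- If `p` has a residue ring of two elements and is fixed up to a unit by `σ`, then `p ^ t`
divides `z` as soon as `p ^ (2 * t)` divides `z * σ z`. -/
theorem pow_dvd_of_pow_two_mul_dvd_mul_map {A : Type*} [CommRing A] [IsDomain A] (σ : A →+* A)
    {p u : A} (hp0 : p ≠ 0) (hu : IsUnit u) (hσ : σ p = u * p) (hp1 : ¬ p ∣ 1)
    (hres : ∀ z, p ∣ z ∨ p ∣ z - 1) (t : ℕ) (z : A) (h : p ^ (2 * t) ∣ z * σ z) : p ^ t ∣ z := by
  induction t generalizing z with
  | zero => simp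
  | succ t ih =>
    have hdvd : p ∣ z * σ z := (dvd_pow_self p (by omega)).trans h
    have hz : p ∣ z := by
      refine (hres z).resolve_right fun h1 => hp1 ?_
      have h2 : p ∣ σ z - 1 := by
        obtain ⟨c, hc⟩ := h1
        refine ⟨u * σ c, ?_⟩
        have := congrArg σ hc
        rw [map_sub, map_one, map_mul, hσ] at this
        rw [this]; ring
      have h3 : (1 : A) = z * σ z - (z - 1) * σ z - (σ z - 1) := by ring
      rw [h3]
      exact dvd_sub (dvd_sub hdvd (h1.mul_right _)) h2
    obtain ⟨y, rfl⟩ := hz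
    rw [pow_succ']
    refine mul_dvd_mul_left p (ih y ?_)
    rw [map_mul, hσ, show p * y * (u * p * σ y) = p ^ 2 * (u * (y * σ y)) by ring,
      show 2 * (t + 1) = 2 + 2 * t by ring, pow_add,
      mul_dvd_mul_iff_left (pow_ne_zero 2 hp0)] at h
    exact hu.dvd_mul_left.mp h

open Polynomial in
theorem monic_X_pow_add_one (k : ℕ) : (X ^ 2 ^ k + 1 : ℤ[X]).Monic :=
  monic_X_pow_add_C 1 (by positivity)

open Polynomial in
theorem prime_X_pow_two_pow_add_one (k : ℕ) : Prime (X ^ 2 ^ k + 1 : ℤ[X]) := by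
  have h : cyclotomic (2 ^ (k + 1)) ℤ = X ^ 2 ^ k + 1 := by
    rw [cyclotomic_prime_pow_eq_geom_sum Nat.prime_two]
    simp [Finset.sum_range_succ, add_comm]
  rw [← h]
  exact (cyclotomic.irreducible (by positivity)).prime

open Polynomial in
/-- Divisibility by an integer in `ℤ[X] / (X ^ 2 ^ k + 1)` can be read off from coefficients. -/
theorem dvd_coeff_of_dvd_mk {k : ℕ} {c : ℤ} {f : ℤ[X]} (hf : f.degree < (2 ^ k : ℕ))
    (h : (c : AdjoinRoot (X ^ 2 ^ k + 1 : ℤ[X])) ∣ AdjoinRoot.mk _ f) (i : ℕ) : c ∣ f.coeff i := by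
  obtain ⟨y, hy⟩ := h
  obtain ⟨g, rfl⟩ := AdjoinRoot.mk_surjective y
  have hdeg : (X ^ 2 ^ k + 1 : ℤ[X]).degree = (2 ^ k : ℕ) :=
    degree_X_pow_add_C (by positivity) 1
  have h1 : AdjoinRoot.mk (X ^ 2 ^ k + 1 : ℤ[X]) f = AdjoinRoot.mk _ (c • g) := by
    rw [hy, zsmul_eq_mul, map_mul, map_intCast]
  have h2 : (X ^ 2 ^ k + 1 : ℤ[X]) ∣ f - c • g := AdjoinRoot.mk_eq_mk.mp h1
  rw [← modByMonic_eq_zero_iff_dvd (monic_X_pow_add_one k), sub_modByMonic, smul_modByMonic,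
    (modByMonic_eq_self_iff (monic_X_pow_add_one k)).mpr (hdeg ▸ hf), sub_eq_zero] at h2
  rw [h2, coeff_smul, smul_eq_mul]
  exact dvd_mul_right _ _

open Polynomial in
/-- In `ℤ[ζ]` with `ζ` a primitive `2 ^ (k + 1)`-th root of unity, an element of squared modulus
divisible by `4 ^ a` is divisible by `2 ^ a`. -/
theorem two_pow_dvd_of_four_pow_dvd_mul_map {k a : ℕ}
    (σ : AdjoinRoot (X ^ 2 ^ k + 1 : ℤ[X]) →+* AdjoinRoot (X ^ 2 ^ k + 1 : ℤ[X]))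
    (hσ : σ (AdjoinRoot.root _) * AdjoinRoot.root _ = 1)
    (z : AdjoinRoot (X ^ 2 ^ k + 1 : ℤ[X])) (h : 4 ^ a ∣ z * σ z) : 2 ^ a ∣ z := by
  have := AdjoinRoot.isDomain_of_prime (prime_X_pow_two_pow_add_one k)
  set x := AdjoinRoot.root (X ^ 2 ^ k + 1 : ℤ[X]) with hxdef
  have hx : x ^ 2 ^ k = -1 := by
    have := AdjoinRoot.eval₂_root (X ^ 2 ^ k + 1 : ℤ[X])
    simp only [eval₂_add, eval₂_pow, eval₂_X, eval₂_one] at this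
    exact eq_neg_of_add_eq_zero_left this
  have h2 := sub_one_pow_dvd_two hx
  have hp2 : x - 1 ∣ 2 := (dvd_pow_self _ (by positivity)).trans h2
  have hp1 : ¬ x - 1 ∣ 1 := by
    intro h1
    let ε : AdjoinRoot (X ^ 2 ^ k + 1 : ℤ[X]) →+* ZMod 2 :=
      AdjoinRoot.lift (Int.castRingHom _) 1 (by simp; decide)
    have := map_dvd ε h1
    rw [map_sub, map_one, show ε x = 1 from AdjoinRoot.lift_root _, sub_self,
      zero_dvd_iff] at this
    exact one_ne_zero this
  have hp0 : x - 1 ≠ 0 := by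
    intro h0
    rw [h0, zero_dvd_iff] at hp2
    have h4 := dvd_coeff_of_dvd_mk (k := k) (c := 0) (f := C 2)
      (by rw [degree_C two_ne_zero]; exact_mod_cast Nat.two_pow_pos k)
      (by rw [AdjoinRoot.mk_C]; simp [hp2]) 0
    simp at h4
  have hres : ∀ z, x - 1 ∣ z ∨ x - 1 ∣ z - 1 := by
    intro z
    obtain ⟨f, rfl⟩ := AdjoinRoot.mk_surjective z
    obtain ⟨q, hq⟩ := X_sub_C_dvd_sub_C_eval (a := 1) (p := f)
    have hf : AdjoinRoot.mk (X ^ 2 ^ k + 1 : ℤ[X]) f =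
        (x - 1) * AdjoinRoot.mk _ q + ((f.eval 1 : ℤ) : AdjoinRoot (X ^ 2 ^ k + 1 : ℤ[X])) := by
      have := congrArg (AdjoinRoot.mk (X ^ 2 ^ k + 1 : ℤ[X])) (sub_eq_iff_eq_add.mp hq)
      simpa [hxdef] using this
    rcases Int.even_or_odd' (f.eval 1) with ⟨c, hc | hc⟩
    · left
      rw [hf, hc]
      push_cast
      exact dvd_add (dvd_mul_right _ _) (hp2.mul_right _)
    · right
      rw [hf, hc]
      push_cast
      rw [add_sub_assoc, add_sub_cancel_right]
      exact dvd_add (dvd_mul_right _ _) (hp2.mul_right _)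
  have hu : IsUnit (-σ x) := (IsUnit.of_mul_eq_one x hσ).neg
  have hσp : σ (x - 1) = -σ x * (x - 1) := by
    rw [map_sub, map_one]; linear_combination hσ
  have h4 : (x - 1) ^ (2 * (2 ^ k * a)) ∣ z * σ z := by
    refine dvd_trans ?_ h
    rw [show 2 * (2 ^ k * a) = 2 ^ k * (2 * a) by ring, pow_mul,
      show (4 : AdjoinRoot (X ^ 2 ^ k + 1 : ℤ[X])) ^ a = 2 ^ (2 * a) by rw [pow_mul]; norm_num]
    exact pow_dvd_pow_of_dvd h2 _
  have h5 := pow_dvd_of_pow_two_mul_dvd_mul_map σ hp0 hu hσp hp1 hres _ z h4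
  rw [pow_mul] at h5
  exact (pow_dvd_pow_of_dvd (two_dvd_sub_one_pow hx) a).trans h5

theorem sum_mul_sum_eq {n : ℕ} [NeZero n] {A : Type*} [CommRing A] {v : ZMod n → ℤ}
    (hv : ∀ s, ∑ j, v j * v (j + s) = if s = 0 then (n : ℤ) else 0) (f : ZMod n → A) :
    ∑ j, ∑ i, ((v j * v i : ℤ) : A) * f (i - j) = n * f 0 := by
  have h : ∀ j, ∑ i, ((v j * v i : ℤ) : A) * f (i - j) =
      ∑ s, ((v j * v (j + s) : ℤ) : A) * f s := fun j =>
    Fintype.sum_equiv (Equiv.subRight j) _ _ fun i => by simp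
  simp_rw [h]
  rw [Finset.sum_comm]
  simp_rw [← Finset.sum_mul, ← Int.cast_sum, hv]
  simp

/-- The sum of `v` over the residue class of `i` modulo `2 ^ k`. -/
def foldSum {n : ℕ} [NeZero n] (v : ZMod n → ℤ) (k i : ℕ) : ℤ :=
  ∑ j : ZMod n, if j.val % 2 ^ k = i then v j else 0

theorem foldSum_succ_add {n : ℕ} [NeZero n] (v : ZMod n → ℤ) {k i : ℕ} (hi : i < 2 ^ k) :
    foldSum v (k + 1) i + foldSum v (k + 1) (i + 2 ^ k) = foldSum v k i := by
  unfold foldSum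
  rw [← Finset.sum_add_distrib]
  refine Finset.sum_congr rfl fun j _ => ?_
  have h1 : j.val % 2 ^ (k + 1) = j.val % 2 ^ k + 2 ^ k * (j.val / 2 ^ k % 2) := Nat.mod_pow_succ
  have h2 : j.val % 2 ^ k < 2 ^ k := Nat.mod_lt _ (by positivity)
  rcases Nat.mod_two_eq_zero_or_one (j.val / 2 ^ k) with h | h <;> rw [h1, h] <;>
    split_ifs <;> omega

theorem pow_eq_sum_of_pow_eq_neg_one {A : Type*} [CommRing A] {x : A} {k : ℕ}
    (hx : x ^ 2 ^ k = -1) (m : ℕ) :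
    x ^ m = ∑ i ∈ Finset.range (2 ^ k), ((if m % 2 ^ (k + 1) = i then (1 : A) else 0) -
      if m % 2 ^ (k + 1) = i + 2 ^ k then 1 else 0) * x ^ i := by
  have h0 : x ^ 2 ^ (k + 1) = 1 := by rw [pow_succ, pow_mul, hx]; norm_num
  rw [pow_eq_pow_mod m h0]
  have hlt : m % 2 ^ (k + 1) < 2 ^ (k + 1) := Nat.mod_lt _ (by positivity)
  generalize m % 2 ^ (k + 1) = r at hlt
  rw [pow_succ] at hlt
  simp_rw [sub_mul, Finset.sum_sub_distrib]
  rcases lt_or_ge r (2 ^ k) with h | h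
  · rw [Finset.sum_eq_single_of_mem r (Finset.mem_range.mpr h) (fun b _ hb => by simp [hb.symm]),
      Finset.sum_eq_zero (fun i _ => by rw [if_neg (by omega), zero_mul])]
    simp
  · obtain ⟨q, rfl⟩ := Nat.exists_eq_add_of_le' h
    rw [Finset.sum_eq_zero (fun i hi => by
        have := Finset.mem_range.mp hi
        rw [if_neg (by omega), zero_mul]),
      Finset.sum_eq_single_of_mem q (Finset.mem_range.mpr (by omega))
        (fun b _ hb => by rw [if_neg (by omega), zero_mul])]
    simp [pow_add, hx]

open Polynomial in
theorem two_pow_dvd_foldSum_sub {n : ℕ} [NeZero n] {v : ZMod n → ℤ}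
    (hv : ∀ s, ∑ j, v j * v (j + s) = if s = 0 then (n : ℤ) else 0) {a k : ℕ}
    (ha : 4 ^ a ∣ n) (hk : 2 ^ (k + 1) ∣ n) {i : ℕ} (hi : i < 2 ^ k) :
    2 ^ a ∣ foldSum v (k + 1) i - foldSum v (k + 1) (i + 2 ^ k) := by
  set x := AdjoinRoot.root (X ^ 2 ^ k + 1 : ℤ[X]) with hxdef
  have hx : x ^ 2 ^ k = -1 := by
    have := AdjoinRoot.eval₂_root (X ^ 2 ^ k + 1 : ℤ[X])
    simp only [eval₂_add, eval₂_pow, eval₂_X, eval₂_one] at this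
    exact eq_neg_of_add_eq_zero_left this
  have hxn : x ^ n = 1 := by
    obtain ⟨c, hc⟩ := hk
    rw [hc, pow_mul, pow_succ, pow_mul, hx]; norm_num
  have hyx : -x ^ (2 ^ k - 1) * x = 1 := by
    rw [neg_mul, ← pow_succ, Nat.sub_add_cancel Nat.one_le_two_pow, hx, neg_neg]
  have hy : (-x ^ (2 ^ k - 1)) ^ 2 ^ k = -1 := by
    have h := congrArg (· ^ 2 ^ k) hyx
    simp only [mul_pow, hx, one_pow] at h
    linear_combination -h
  let σ : AdjoinRoot (X ^ 2 ^ k + 1 : ℤ[X]) →+* AdjoinRoot (X ^ 2 ^ k + 1 : ℤ[X]) :=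
    AdjoinRoot.lift (Int.castRingHom _) (-x ^ (2 ^ k - 1)) (by simp [hy])
  have hσ : σ x * x = 1 := by
    rw [show σ x = _ from AdjoinRoot.lift_root _, hyx]
  let ψ := AddChar.zmodChar n hxn
  have hψ : ∀ j, ψ j = x ^ j.val := AddChar.zmodChar_apply hxn
  have hσψ : ∀ j, σ (ψ j) * ψ j = 1 := fun j => by
    rw [hψ, map_pow, ← mul_pow, hσ, one_pow]
  let P : ℤ[X] := ∑ i ∈ Finset.range (2 ^ k),
    C (foldSum v (k + 1) i - foldSum v (k + 1) (i + 2 ^ k)) * X ^ i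
  have hP : AdjoinRoot.mk (X ^ 2 ^ k + 1 : ℤ[X]) P = ∑ j, (v j : AdjoinRoot _) * ψ j := by
    simp_rw [hψ, pow_eq_sum_of_pow_eq_neg_one hx (ZMod.val _), Finset.mul_sum]
    rw [Finset.sum_comm, map_sum]
    refine Finset.sum_congr rfl fun i _ => ?_
    simp_rw [← mul_assoc, ← Finset.sum_mul]
    rw [map_mul, map_pow, AdjoinRoot.mk_X, foldSum, foldSum, ← Finset.sum_sub_distrib]
    congr 1
    rw [show ∀ c : ℤ, AdjoinRoot.mk (X ^ 2 ^ k + 1 : ℤ[X]) (C c) = (c : AdjoinRoot _) from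
      fun c => by simp, Int.cast_sum]
    refine Finset.sum_congr rfl fun j _ => ?_
    split_ifs <;> simp
  have hn : AdjoinRoot.mk (X ^ 2 ^ k + 1 : ℤ[X]) P * σ (AdjoinRoot.mk _ P) =
      (n : AdjoinRoot (X ^ 2 ^ k + 1 : ℤ[X])) := by
    have h := sum_mul_sum_eq hv ψ
    rw [AddChar.map_zero_eq_one, mul_one] at h
    rw [hP, map_sum, ← h, mul_comm, Finset.sum_mul_sum]
    refine Finset.sum_congr rfl fun j _ => Finset.sum_congr rfl fun l _ => ?_
    have h1 : ψ l = ψ (l - j) * ψ j := by rw [← AddChar.map_add_eq_mul, sub_add_cancel]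
    rw [map_mul, map_intCast, h1]
    push_cast
    linear_combination ((v j : AdjoinRoot (X ^ 2 ^ k + 1 : ℤ[X])) * v l * ψ (l - j)) * hσψ j
  have hdvd := two_pow_dvd_of_four_pow_dvd_mul_map σ hσ (AdjoinRoot.mk _ P) (a := a) (by
    rw [hn]; exact_mod_cast Nat.cast_dvd_cast ha)
  have hdeg : P.degree < (2 ^ k : ℕ) := by
    refine lt_of_le_of_lt (degree_sum_le _ _) ?_
    rw [Finset.sup_lt_iff (WithBot.bot_lt_coe _)]
    intro i hi
    exact (degree_C_mul_X_pow_le _ _).trans_lt (by exact_mod_cast Finset.mem_range.mp hi)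
  have hc := dvd_coeff_of_dvd_mk (c := 2 ^ a) hdeg (by push_cast; exact hdvd) i
  simp only [P, finsetSum_coeff, coeff_C_mul, coeff_X_pow] at hc
  simpa [hi] using hc

theorem sum_foldSum_sq {n : ℕ} [NeZero n] {v : ZMod n → ℤ}
    (hv : ∀ s, ∑ j, v j * v (j + s) = if s = 0 then (n : ℤ) else 0) {k : ℕ} (hk : 2 ^ k ∣ n) :
    ∑ i ∈ Finset.range (2 ^ k), foldSum v k i ^ 2 = n := by
  have h := sum_mul_sum_eq hv (fun s => if ZMod.castHom hk (ZMod (2 ^ k)) s = 0 then (1 : ℤ) else 0)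
  simp only [map_zero, if_true, mul_one] at h
  rw [← h]
  simp_rw [foldSum, sq, Finset.sum_mul_sum]
  rw [Finset.sum_comm]
  refine Finset.sum_congr rfl fun j _ => ?_
  rw [Finset.sum_comm]
  refine Finset.sum_congr rfl fun l _ => ?_
  rw [Finset.sum_eq_single_of_mem (j.val % 2 ^ k)
    (Finset.mem_range.mpr (Nat.mod_lt _ (by positivity)))
    (fun b _ hb => by rw [if_neg hb.symm, zero_mul]), if_pos rfl]
  have h1 : ZMod.castHom hk (ZMod (2 ^ k)) (l - j) = 0 ↔ l.val % 2 ^ k = j.val % 2 ^ k := by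
    rw [map_sub, sub_eq_zero, ZMod.castHom_apply, ZMod.castHom_apply, ZMod.cast_eq_val,
      ZMod.cast_eq_val, ZMod.natCast_eq_natCast_iff']
  simp only [h1]
  split_ifs <;> simp

theorem odd_sum_iff_odd_card {ι : Type*} {s : Finset ι} {f : ι → ℤ} (hf : ∀ i ∈ s, Odd (f i)) :
    Odd (∑ i ∈ s, f i) ↔ Odd s.card := by
  have h : Even (∑ i ∈ s, (f i - 1)) := Finset.even_sum _ fun i hi => (hf i hi).sub_odd odd_one
  rw [Finset.sum_sub_distrib, Int.even_sub'] at h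
  simpa using h

theorem odd_foldSum {n : ℕ} [NeZero n] {v : ZMod n → ℤ} (hodd : ∀ j, Odd (v j)) {k : ℕ}
    {m : ℕ} (hm : Odd m) (hn : n = 2 ^ k * m) {i : ℕ} (hi : i < 2 ^ k) : Odd (foldSum v k i) := by
  have h1 : foldSum v k i = ∑ j : ZMod n with j.val % 2 ^ k = i, v j := by
    rw [foldSum, Finset.sum_filter]
  have h2 : (Finset.univ.filter fun j : ZMod n => j.val % 2 ^ k = i).card = m := by
    have h3 := Nat.count_modEq_card n (Nat.two_pow_pos k) i
    rw [hn, Nat.mul_mod_right, Nat.mul_div_cancel_left _ (Nat.two_pow_pos k), if_neg (by omega),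
      add_zero, ← hn, Nat.count_eq_card_filter_range] at h3
    rw [← h3]
    refine Finset.card_bij (fun j _ => j.val) ?_ (fun _ _ _ _ h => ZMod.val_injective n h) ?_
    · intro j hj
      simp only [Finset.mem_filter, Finset.mem_univ, true_and, Finset.mem_range] at hj ⊢
      exact ⟨ZMod.val_lt j, by rw [Nat.ModEq, hj, Nat.mod_eq_of_lt hi]⟩
    · intro b hb
      simp only [Finset.mem_filter, Finset.mem_range] at hb
      refine ⟨(b : ZMod n), ?_, ZMod.val_cast_of_lt hb.1⟩
      simp only [Finset.mem_filter, Finset.mem_univ, true_and]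
      rw [ZMod.val_cast_of_lt hb.1]
      exact Eq.trans hb.2 (Nat.mod_eq_of_lt hi)
  rwa [h1, odd_sum_iff_odd_card fun j _ => hodd j, h2]

theorem foldSum_eq_two_pow_mul_odd {n : ℕ} [NeZero n] {v : ZMod n → ℤ} (hodd : ∀ j, Odd (v j))
    (hv : ∀ s, ∑ j, v j * v (j + s) = if s = 0 then (n : ℤ) else 0) {a m : ℕ} (hm : Odd m)
    (hn : n = 4 ^ a * m) {t : ℕ} (ht : t < a) {k : ℕ} (hk : k + t = 2 * a) {i : ℕ}
    (hi : i < 2 ^ k) : ∃ c, Odd c ∧ foldSum v k i = 2 ^ t * c := by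
  have h4 : 4 ^ a = 2 ^ (2 * a) := by rw [pow_mul]; norm_num
  induction t generalizing k i with
  | zero =>
    refine ⟨_, odd_foldSum hodd hm ?_ hi, by simp⟩
    rw [hn, h4, ← hk, add_zero]
  | succ t ih =>
    obtain ⟨c, hc, hci⟩ := ih (by omega) (k := k + 1) (by omega) (i := i) (by rw [pow_succ]; omega)
    obtain ⟨w, hw⟩ := two_pow_dvd_foldSum_sub hv (a := a) (k := k) (hn ▸ dvd_mul_right _ _)
      (by rw [hn, h4]; exact (pow_dvd_pow 2 (by omega)).mul_right m) hi
    obtain ⟨b, rfl⟩ : ∃ b, a = t + 1 + (b + 1) := ⟨a - t - 2, by omega⟩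
    refine ⟨c - 2 ^ (b + 1) * w, hc.sub_even ?_, ?_⟩
    · rw [pow_succ, mul_comm _ (2 : ℤ), mul_assoc]; exact even_two_mul _
    · rw [← foldSum_succ_add v hi]
      rw [pow_add] at hw
      rw [pow_succ]
      linear_combination 2 * hci - hw

theorem lt_two_of_perfect_sequence {n : ℕ} [NeZero n] {v : ZMod n → ℤ} (hodd : ∀ j, Odd (v j))
    (hv : ∀ s, ∑ j, v j * v (j + s) = if s = 0 then (n : ℤ) else 0) {a m : ℕ} (hm : Odd m)
    (hn : n = 4 ^ a * m) : a < 2 := by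
  by_contra! ha
  obtain ⟨b, rfl⟩ := Nat.exists_eq_add_of_le' ha
  have key : ∀ i, ∃ c, i < 2 ^ (b + 3) → Odd c ∧ foldSum v (b + 3) i = 2 ^ (b + 1) * c := by
    intro i
    by_cases hi : i < 2 ^ (b + 3)
    · obtain ⟨c, hc⟩ := foldSum_eq_two_pow_mul_odd hodd hv hm hn (t := b + 1) (by omega)
        (k := b + 3) (by omega) hi
      exact ⟨c, fun _ => hc⟩
    · exact ⟨0, fun h => absurd h hi⟩
  choose c hc using key
  have h4 : 4 ^ (b + 2) = 2 ^ (2 * (b + 2)) := by rw [pow_mul]; norm_num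
  have hsum := sum_foldSum_sq hv (k := b + 3)
    (by rw [hn, h4]; exact (pow_dvd_pow 2 (by omega)).mul_right m)
  have h1 : ∑ i ∈ Finset.range (2 ^ (b + 3)), foldSum v (b + 3) i ^ 2 =
      4 ^ (b + 1) * ∑ i ∈ Finset.range (2 ^ (b + 3)), c i ^ 2 := by
    rw [Finset.mul_sum]
    refine Finset.sum_congr rfl fun i hi => ?_
    rw [(hc i (Finset.mem_range.mp hi)).2, mul_pow, ← pow_mul, mul_comm _ 2, pow_mul]
    norm_num
  have h2 : (8 : ℤ) ∣ ∑ i ∈ Finset.range (2 ^ (b + 3)), (c i ^ 2 - 1) :=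
    Finset.dvd_sum fun i hi => Int.eight_dvd_sq_sub_one_of_odd (hc i (Finset.mem_range.mp hi)).1
  rw [h1, hn, pow_succ 4 (b + 1)] at hsum
  push_cast at hsum
  rw [mul_assoc] at hsum
  have h3 := mul_left_cancel₀ (by positivity) hsum
  rw [Finset.sum_sub_distrib, h3] at h2
  simp only [Finset.sum_const, Finset.card_range, nsmul_eq_mul, mul_one, pow_add] at h2
  push_cast at h2
  obtain ⟨q, rfl⟩ := hm
  push_cast at h2
  omega

theorem sum_eq_sq_of_perfect_sequence {n : ℕ} [NeZero n] {v : ZMod n → ℤ}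
    (hv : ∀ s, ∑ j, v j * v (j + s) = if s = 0 then (n : ℤ) else 0) : (∑ j, v j) ^ 2 = n := by
  have h := sum_mul_sum_eq hv (fun _ => (1 : ℤ))
  simp only [mul_one, Int.cast_id] at h
  rw [sq, Finset.sum_mul_sum, h]

theorem exists_odd_of_perfect_sequence {n : ℕ} [NeZero n] (hn : 4 ≤ n) {v : ZMod n → ℤ}
    (hodd : ∀ j, Odd (v j))
    (hv : ∀ s, ∑ j, v j * v (j + s) = if s = 0 then (n : ℤ) else 0) :
    ∃ h : ℕ, 0 < h ∧ Odd h ∧ n = 4 * h ^ 2 ∧ (∑ j, v j = 2 * h ∨ ∑ j, v j = -(2 * h)) := by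
  have hsq := sum_eq_sq_of_perfect_sequence hv
  have : Fact (1 < n) := ⟨by omega⟩
  have hcard : Odd (∑ j, v j * v (j + 1)) ↔ Odd n := by
    rw [odd_sum_iff_odd_card fun j _ => (hodd j).mul (hodd (j + 1))]
    simp [ZMod.card]
  rw [hv, if_neg one_ne_zero] at hcard
  have heven : Even (∑ j, v j) := by
    have : ¬ Odd n := fun h => by simpa using hcard.mpr h
    have h1 : Even ((∑ j, v j) ^ 2) := by
      rw [hsq]; exact_mod_cast Nat.not_odd_iff_even.mp this
    exact (Int.even_pow.mp h1).1
  obtain ⟨r, hr⟩ := heven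
  have hn4 : n = 4 * r.natAbs ^ 2 := by
    zify
    rw [sq_abs, ← hsq, hr]; ring
  have hpos : 0 < r.natAbs := by
    by_contra! h0
    rw [Nat.le_zero.mp h0] at hn4
    omega
  refine ⟨r.natAbs, hpos, ?_, hn4, ?_⟩
  · obtain ⟨b, o, ho, hro⟩ := Nat.exists_eq_two_pow_mul_odd hpos.ne'
    have h := lt_two_of_perfect_sequence hodd hv (a := b + 1) (m := o ^ 2) ho.pow (by
      rw [hn4, hro, mul_pow, ← pow_mul, mul_comm b 2, pow_mul, pow_succ]; norm_num; ring)
    obtain rfl : b = 0 := by omega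
    rw [hro]; simpa using ho
  · rw [hr]; omega

/-- Every circulant Hadamard matrix of order `n ≥ 4` satisfies `n = 4 h ^ 2` for some
positive odd integer `h`, and its row sums are all equal to `2 h` or all equal to
`-2 h`. -/
theorem circulant_hadamard_order_and_row_sums (n : ℕ) (hn : 4 ≤ n)
    (H : Matrix (Fin n) (Fin n) ℚ)
    (hent : ∀ i j, H i j = 1 ∨ H i j = -1)
    (hHad : H * Hᵀ = (n : ℚ) • (1 : Matrix (Fin n) (Fin n) ℚ))
    (hcirc : ∀ i j k : Fin n, H (i + k) (j + k) = H i j) :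
    ∃ h : ℕ, 0 < h ∧ Odd h ∧ n = 4 * h ^ 2 ∧
      ((∀ i, ∑ j, H i j = 2 * h) ∨ (∀ i, ∑ j, H i j = -(2 * h))) := by
  obtain ⟨n, rfl⟩ := Nat.exists_eq_succ_of_ne_zero (show n ≠ 0 by omega)
  have hex : ∀ j : ZMod (n + 1), ∃ z : ℤ, Odd z ∧ (z : ℚ) = H 0 j := fun j => by
    rcases hent 0 j with h | h
    · exact ⟨1, odd_one, by rw [h]; norm_num⟩
    · exact ⟨-1, odd_one.neg, by rw [h]; norm_num⟩
  choose v hodd hvH using hex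
  have hH : ∀ i j : ZMod (n + 1), H i j = v (j - i) := fun i j => by
    rw [hvH]
    have h := hcirc (0 : ZMod (n + 1)) (j - i) i
    change H ((0 : ZMod (n + 1)) + i) ((j - i : ZMod (n + 1)) + i) = _ at h
    rw [zero_add, sub_add_cancel] at h
    exact h
  have hprod : ∀ i j, ∑ l, H i l * H j l = ((n + 1 : ℕ) : ℚ) • if i = j then (1 : ℚ) else 0 :=
    fun i j => by
      have h := congrFun (congrFun hHad i) j
      rwa [Matrix.mul_apply, Matrix.smul_apply, Matrix.one_apply] at h
  have hv : ∀ s, ∑ j, v j * v (j + s) = if s = 0 then ((n + 1 : ℕ) : ℤ) else 0 := by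
    intro s
    have h := hprod (0 : ZMod (n + 1)) (-s : ZMod (n + 1))
    have h2 : ∑ j : ZMod (n + 1), (v j : ℚ) * v (j + s) =
        if s = 0 then ((n + 1 : ℕ) : ℚ) else 0 := by
      rw [show (if s = 0 then ((n + 1 : ℕ) : ℚ) else 0) =
        ((n + 1 : ℕ) : ℚ) • (if (0 : ZMod (n + 1)) = -s then (1 : ℚ) else 0) by
          simp [eq_comm (a := (0 : ZMod (n + 1)))]]
      refine Eq.trans ?_ h
      refine Finset.sum_congr rfl fun j _ => ?_
      erw [hH, hH]
      rw [sub_zero, sub_neg_eq_add]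
    exact_mod_cast h2
  obtain ⟨h, hpos, hh, hn4, hsum⟩ := exists_odd_of_perfect_sequence hn hodd hv
  have hrow : ∀ i : ZMod (n + 1), ∑ j : ZMod (n + 1), H i j = ((∑ j, v j : ℤ) : ℚ) := fun i => by
    rw [Int.cast_sum]
    exact Fintype.sum_equiv (Equiv.subRight i) _ _ fun j => hH i j
  refine ⟨h, hpos, hh, hn4, hsum.imp (fun hs i => ?_) (fun hs i => ?_)⟩ <;>
  · refine (hrow i).trans ?_
    rw [hs]
    push_cast
    rfl
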